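/- Under the full expected growth condition and the lower-rate condition, let α ∈ (0,δ), let u : Ē → U be an ordinary feedback selector, and let (s_m) be a sequence of measurable functions E → [0,∞) with s_0 ≡ 0 and, for all m ∈ ℕ and x ∈ E, s_{m+1}(x) = L_α f(x,u_φ(x)) + H_α r(x,u_φ(x)) + G_α s_m(x,u_φ(x)). Set M′ = M(1+b/c)(1+bK_λ)/c. Then for every m ∈ ℕ and x ∈ E: |L(f − α·s_{m+1})(x,u_φ(x)) + H r(x,u_φ(x))| ≤ M′·g(x), where L = L_0, H = H_0 are the undiscounted operators and L(f − α·s_{m+1})(x,u_φ(x)) = ∫_0^{t*(x)} e^{−Λ^{u}(x,s)}·[f(φ(x,s),u(φ(x,s))) − α·s_{m+1}(φ(x,s))]ds with Λ^u(x,s)=∫_0^s λ(φ(x,θ),u(φ(x,θ)))dθ. -/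

import Mathlib

open MeasureTheory ENNReal Set Filter Topology

namespace PDMP

noncomputable section

/-- Data of a controlled PDMP: state space `E ⊆ ℝⁿ`, flow `φ`, feasible action sets `feas = 𝕌`,
jump rate `lam = λ` and transition kernel `Q`. -/
structure Setting (n : ℕ) (U : Type*) [MeasurableSpace U] where
  E : Set (Fin n → ℝ)
  φ : (Fin n → ℝ) → ℝ → (Fin n → ℝ)
  feas : (Fin n → ℝ) → Set U
  lam : (Fin n → ℝ) → U → ℝ
  Q : (Fin n → ℝ) → U → Measure (Fin n → ℝ)

/-- A relaxed control: a time component (measures on the action space along the flow) and a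
boundary component. -/
structure RControl (U : Type*) [MeasurableSpace U] where
  time : ℝ → Measure U
  bdry : Measure U

variable {n : ℕ} {U : Type*} [MeasurableSpace U]

namespace Setting

variable (S : Setting n U)

/-- The exit time `t*(x)` from `E`, valued in `[0,∞]` (`∞` if the flow never reaches `∂E`). -/
def ts (x : Fin n → ℝ) : ℝ≥0∞ :=
  sInf {T : ℝ≥0∞ | ∃ t : ℝ, 0 < t ∧ S.φ x t ∈ frontier S.E ∧ T = ENNReal.ofReal t}

/-- Real version of the exit time (junk value `0` when `t*(x) = ∞`). -/
def tsR (x : Fin n → ℝ) : ℝ := (S.ts x).toReal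

/-- The time interval `[0, t*(x))` as a subset of `ℝ`. -/
def fs (x : Fin n → ℝ) : Set ℝ := {t : ℝ | 0 ≤ t ∧ ENNReal.ofReal t < S.ts x}

/-- `λ(y,μ) = ∫ λ(y,u) μ(du)`, as an extended nonnegative real. -/
def lamMix (y : Fin n → ℝ) (m : Measure U) : ℝ≥0∞ := ∫⁻ u, ENNReal.ofReal (S.lam y u) ∂m

/-- `Q k (y,a) = ∫_E k(z) Q(y,a;dz)`. -/
def Qpt (k : (Fin n → ℝ) → ℝ≥0∞) (y : Fin n → ℝ) (a : U) : ℝ≥0∞ := ∫⁻ z in S.E, k z ∂(S.Q y a)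

/-- `Q k (y,μ) = ∫∫_E k(z) Q(y,u;dz) μ(du)`. -/
def QMix (k : (Fin n → ℝ) → ℝ≥0∞) (y : Fin n → ℝ) (m : Measure U) : ℝ≥0∞ :=
  ∫⁻ u, S.Qpt k y u ∂m

/-- `λQ k (y,μ) = ∫ λ(y,u) ∫_E k(z) Q(y,u;dz) μ(du)`. -/
def lamQMix (k : (Fin n → ℝ) → ℝ≥0∞) (y : Fin n → ℝ) (m : Measure U) : ℝ≥0∞ :=
  ∫⁻ u, ENNReal.ofReal (S.lam y u) * S.Qpt k y u ∂m

/-- `Λ^μ(x,t) = ∫_0^t λ(φ(x,s), μ(s)) ds`. -/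
def Lam (x : Fin n → ℝ) (Θ : RControl U) (t : ℝ) : ℝ≥0∞ :=
  ∫⁻ s in Set.Ioc (0 : ℝ) t, S.lamMix (S.φ x s) (Θ.time s)

/-- The integrating factor `e^{-α t - Λ^μ(x,t)}` (equal to `0` when `Λ^μ(x,t) = ∞`). -/
def weight (α : ℝ) (x : Fin n → ℝ) (Θ : RControl U) (t : ℝ) : ℝ≥0∞ :=
  if S.Lam x Θ t = ⊤ then 0 else ENNReal.ofReal (Real.exp (-(α * t) - (S.Lam x Θ t).toReal))

/-- `𝓛_α(x,Θ) = ∫_0^{t*(x)} e^{-α s - Λ^μ(x,s)} ds`. -/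
def curlyL (α : ℝ) (x : Fin n → ℝ) (Θ : RControl U) : ℝ≥0∞ :=
  ∫⁻ t in S.fs x, S.weight α x Θ t

/-- `L_α v(x,Θ) = ∫_0^{t*(x)} e^{-α s - Λ^μ(x,s)} v(φ(x,s), μ(s)) ds`. -/
def Lop (α : ℝ) (v : (Fin n → ℝ) → Measure U → ℝ≥0∞) (x : Fin n → ℝ) (Θ : RControl U) :
    ℝ≥0∞ :=
  ∫⁻ t in S.fs x, S.weight α x Θ t * v (S.φ x t) (Θ.time t)

/-- `H_α w(x,Θ) = e^{-α t*(x) - Λ^μ(x,t*(x))} w(φ(x,t*(x)), μ∂)` when `t*(x) < ∞`, else `0`. -/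
def Hop (α : ℝ) (p : (Fin n → ℝ) → Measure U → ℝ≥0∞) (x : Fin n → ℝ) (Θ : RControl U) :
    ℝ≥0∞ :=
  if S.ts x < ⊤ then S.weight α x Θ (S.tsR x) * p (S.φ x (S.tsR x)) Θ.bdry else 0

/-- `G_α k(x,Θ)` for nonnegative `k`. -/
def Gop (α : ℝ) (k : (Fin n → ℝ) → ℝ≥0∞) (x : Fin n → ℝ) (Θ : RControl U) : ℝ≥0∞ :=
  S.Lop α (fun y m => S.lamQMix k y m) x Θ + S.Hop α (fun y m => S.QMix k y m) x Θ

/-- `G_α h(x,Θ)` for signed `h`, as `G_α h⁺ - G_α h⁻` in the extended reals. -/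
def GopS (α : ℝ) (h : (Fin n → ℝ) → ℝ) (x : Fin n → ℝ) (Θ : RControl U) : EReal :=
  ((S.Gop α (fun z => ENNReal.ofReal (h z)) x Θ : ℝ≥0∞) : EReal)
    - ((S.Gop α (fun z => ENNReal.ofReal (-h z)) x Θ : ℝ≥0∞) : EReal)

/-- Admissibility of a relaxed control at `x`, i.e. membership in `V^r(x)`. -/
def IsRelaxed (x : Fin n → ℝ) (Θ : RControl U) : Prop :=
  Measurable Θ.time ∧ (∀ t, IsProbabilityMeasure (Θ.time t)) ∧
    (∀ᵐ t ∂(volume.restrict (S.fs x)), Θ.time t (S.feas (S.φ x t)) = 1) ∧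
    IsProbabilityMeasure Θ.bdry ∧
    (S.ts x < ⊤ → Θ.bdry (S.feas (S.φ x (S.tsR x))) = 1)

/-- The relaxed control `u_φ(x)` induced by a feedback selector `u`. -/
def feedback (u : (Fin n → ℝ) → U) (x : Fin n → ℝ) : RControl U :=
  ⟨fun t => Measure.dirac (u (S.φ x t)), Measure.dirac (u (S.φ x (S.tsR x)))⟩

/-- Ordinary feedback measurable selectors: `u(y) ∈ 𝕌(y)`. -/
def IsSelector (u : (Fin n → ℝ) → U) : Prop :=
  Measurable u ∧ ∀ y ∈ closure S.E, u y ∈ S.feas y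

/-- Membership of `v` in `M^ac(E)` with derivative `Xv` along the flow; boundary values of `v`
are the limits along the flow. -/
def MemMac (v Xv : (Fin n → ℝ) → ℝ) : Prop :=
  Measurable v ∧ Measurable Xv ∧
    (∀ x ∈ S.E, ∀ t ∈ S.fs x,
      IntervalIntegrable (fun s => Xv (S.φ x s)) volume 0 t ∧
        v (S.φ x t) - v x = ∫ s in (0 : ℝ)..t, Xv (S.φ x s)) ∧
    (∀ x ∈ S.E, S.ts x < ⊤ →
      Tendsto (fun t => v (S.φ x t)) (𝓝[<] S.tsR x) (𝓝 (v (S.φ x (S.tsR x)))))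

/-- The weighted supremum norm `‖h‖_g = sup_{x ∈ E} |h(x)|/g(x)`. -/
def gnorm (h g : (Fin n → ℝ) → ℝ) : ℝ := sSup ((fun x => |h x| / g x) '' S.E)

/-- Membership in `B_g(E)`. -/
def memBg (h g : (Fin n → ℝ) → ℝ) : Prop :=
  Measurable h ∧ BddAbove ((fun x => |h x| / g x) '' S.E)

/-- `v(y,μ) = ∫ v(y,u) μ(du)` for a nonnegative cost `v` on `Ē × U`, as a function of the
state and a measure on actions. -/
def mix (_S : Setting n U) (v : (Fin n → ℝ) → U → ℝ) : (Fin n → ℝ) → Measure U → ℝ≥0∞ :=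
  fun y m => ∫⁻ u, ENNReal.ofReal (v y u) ∂m

/-- The quantity `-ρ 𝓛_α(x,Θ) + L_α f(x,Θ) + H_α r(x,Θ) + G_α h(x,Θ)` appearing in the
one-stage optimization problems, valued in the extended reals. -/
def oneStage (α ρ : ℝ) (f r : (Fin n → ℝ) → U → ℝ) (h : (Fin n → ℝ) → ℝ) (x : Fin n → ℝ)
    (Θ : RControl U) : EReal :=
  (-(ρ : EReal)) * ((S.curlyL α x Θ : ℝ≥0∞) : EReal)
    + ((S.Lop α (S.mix f) x Θ : ℝ≥0∞) : EReal)
    + ((S.Hop α (S.mix r) x Θ : ℝ≥0∞) : EReal) + S.GopS α h x Θ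

end Setting

/-- The basic structural assumptions on the data of the control problem. -/
structure Basic [TopologicalSpace U] (S : Setting n U) : Prop where
  openE : IsOpen S.E
  nonemptyE : S.E.Nonempty
  contFlow : Continuous (Function.uncurry S.φ)
  flowZero : ∀ x, S.φ x 0 = x
  flowAdd : ∀ x s t, 0 ≤ s → 0 ≤ t → S.φ x (s + t) = S.φ (S.φ x s) t
  feasCompact : ∀ y ∈ closure S.E, IsCompact (S.feas y)
  feasNonempty : ∀ y ∈ closure S.E, (S.feas y).Nonempty
  lamMeas : Measurable (Function.uncurry S.lam)
  lamNonneg : ∀ y ∈ closure S.E, ∀ u, 0 ≤ S.lam y u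
  Qprob : ∀ y u, IsProbabilityMeasure (S.Q y u)
  QsuppE : ∀ y u, S.Q y u S.E = 1
  Qmeas : Measurable fun p : (Fin n → ℝ) × U => S.Q p.1 p.2

/-- The expected growth condition (Assumption 3.1 of the paper, inequalities (Cu1)/(Cu2)). -/
structure ExpGrowth (S : Setting n U) (b c : ℝ) (g Xg rbar : (Fin n → ℝ) → ℝ) : Prop where
  b_nonneg : 0 ≤ b
  c_pos : 0 < c
  g_ge_one : ∀ y, 1 ≤ g y
  g_mac : S.MemMac g Xg
  rbar_meas : Measurable rbar
  rbar_nonneg : ∀ z ∈ frontier S.E, 0 ≤ rbar z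
  drift : ∀ x ∈ S.E, ∀ a ∈ S.feas x,
    ((Xg x + c * g x : ℝ) : EReal)
        + ((ENNReal.ofReal (S.lam x a) * S.Qpt (fun z => ENNReal.ofReal (g z)) x a : ℝ≥0∞) :
            EReal)
      ≤ ((b + S.lam x a * g x : ℝ) : EReal)
  bdryGrowth : ∀ x ∈ S.E, S.ts x < ⊤ → ∀ a ∈ S.feas (S.φ x (S.tsR x)),
    ENNReal.ofReal (rbar (S.φ x (S.tsR x)))
        + S.Qpt (fun z => ENNReal.ofReal (g z)) (S.φ x (S.tsR x)) a
      ≤ ENNReal.ofReal (g (S.φ x (S.tsR x)))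

/-- The full expected growth condition: the bounds on the running and boundary costs
(inequalities (Cu3)/(Cu3a) of Assumption 3.1 of the paper). -/
structure CostBound (S : Setting n U) (c δ M : ℝ) (g rbar : (Fin n → ℝ) → ℝ)
    (f r : (Fin n → ℝ) → U → ℝ) : Prop where
  δ_pos : 0 < δ
  M_nonneg : 0 ≤ M
  f_meas : Measurable (Function.uncurry f)
  f_nonneg : ∀ y ∈ closure S.E, ∀ u, 0 ≤ f y u
  r_meas : Measurable (Function.uncurry r)
  r_nonneg : ∀ z ∈ frontier S.E, ∀ u, 0 ≤ r z u
  f_bound : ∀ x ∈ S.E, ∀ a ∈ S.feas x, f x a ≤ M * g x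
  r_bound : ∀ x ∈ S.E, S.ts x < ⊤ → ∀ a ∈ S.feas (S.φ x (S.tsR x)),
    r (S.φ x (S.tsR x)) a ≤ M / (c + δ) * rbar (S.φ x (S.tsR x))

/-- The lower-rate condition (parts of Assumptions 3.2 and 3.7 of the paper). -/
structure LowerRate (S : Setting n U) (c : ℝ) (lamL : (Fin n → ℝ) → ℝ) (Kl : ℝ) : Prop where
  lamL_meas : Measurable lamL
  lamL_nonneg : ∀ y, 0 ≤ lamL y
  Kl_nonneg : 0 ≤ Kl
  lam_ge : ∀ y ∈ S.E, ∀ a ∈ S.feas y, lamL y ≤ S.lam y a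
  lamL_locInt : ∀ x ∈ S.E, ∀ t ∈ S.fs x,
    IntervalIntegrable (fun s => lamL (S.φ x s)) volume 0 t
  lamL_intTs : ∀ x ∈ S.E, S.ts x < ⊤ →
    IntervalIntegrable (fun s => lamL (S.φ x s)) volume 0 (S.tsR x)
  intBound : ∀ x ∈ S.E,
    (∫⁻ t in S.fs x,
        ENNReal.ofReal (Real.exp (c * t - ∫ s in (0 : ℝ)..t, lamL (S.φ x s))))
      ≤ ENNReal.ofReal Kl
  supInt : ∀ x ∈ S.E, ∀ t ∈ S.fs x,
    (∫⁻ s in Set.Ioc (0 : ℝ) t, ⨆ a ∈ S.feas (S.φ x s), ENNReal.ofReal (S.lam (S.φ x s) a)) < ⊤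
  supIntTs : ∀ x ∈ S.E, S.ts x < ⊤ →
    (∫⁻ s in Set.Ioc (0 : ℝ) (S.tsR x),
        ⨆ a ∈ S.feas (S.φ x s), ENNReal.ofReal (S.lam (S.φ x s) a)) < ⊤

end

end PDMP
open PDMP MeasureTheory ENNReal Set Filter Topology

theorem ac_exp {P : ℝ → ℝ} {T : ℝ} (hT : 0 ≤ T) (hP : AbsolutelyContinuousOnInterval P 0 T)
    (hP0 : ∀ t ∈ Icc 0 T, P t ≤ 0) :
    AbsolutelyContinuousOnInterval (fun t => Real.exp (P t)) 0 T := by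
  have hexp : ∀ a b : ℝ, a ≤ 0 → b ≤ 0 → dist (Real.exp a) (Real.exp b) ≤ dist a b := by
    have key : ∀ a b : ℝ, a ≤ b → b ≤ 0 → Real.exp b - Real.exp a ≤ b - a := by
      intro a b hab hb
      have h1 := Real.add_one_le_exp (a - b)
      have h2 : Real.exp a = Real.exp b * Real.exp (a - b) := by rw [← Real.exp_add]; ring_nf
      have h3 : Real.exp b ≤ 1 := Real.exp_le_one_iff.2 hb
      have h4 := Real.exp_pos b
      rw [h2]
      nlinarith
    intro a b ha hb
    rcases le_total a b with h | h
    · rw [dist_comm, dist_comm a b, Real.dist_eq, Real.dist_eq, abs_of_nonneg (by simpa using h),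
        abs_of_nonneg (by linarith)]
      exact key a b h hb
    · rw [Real.dist_eq, Real.dist_eq, abs_of_nonneg (by simpa using h),
        abs_of_nonneg (by linarith)]
      exact key b a h ha
  rw [absolutelyContinuousOnInterval_iff] at hP ⊢
  intro ε hε
  obtain ⟨d, hd, h⟩ := hP ε hε
  refine ⟨d, hd, fun E hE hE2 => lt_of_le_of_lt (Finset.sum_le_sum fun i hi => ?_) (h E hE hE2)⟩
  have hm := hE.1 i hi
  rw [uIcc_of_le hT] at hm
  exact hexp _ _ (hP0 _ hm.1) (hP0 _ hm.2)

theorem key_real {T α β : ℝ} (hT : 0 ≤ T) (hα : 0 ≤ α) (hβ : 0 ≤ β) {l D G V : ℝ → ℝ}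
    (hl : IntervalIntegrable l volume 0 T) (hl0 : ∀ t ∈ Icc 0 T, 0 ≤ l t)
    (hD : IntervalIntegrable D volume 0 T)
    (hG : ∀ t ∈ Icc 0 T, G t = G 0 + ∫ s in (0:ℝ)..t, D s)
    (hG0 : ∀ t ∈ Icc 0 T, 0 ≤ G t)
    (hV0 : ∀ t ∈ Ioc 0 T, 0 ≤ V t)
    (hV : ∀ t ∈ Ioc 0 T, D t + V t ≤ (l t + α) * G t + β) :
    (∫⁻ t in Ioc 0 T, ENNReal.ofReal (Real.exp (-(α * t) - ∫ s in (0:ℝ)..t, l s))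
        * ENNReal.ofReal (V t))
      + ENNReal.ofReal (Real.exp (-(α * T) - ∫ s in (0:ℝ)..T, l s)) * ENNReal.ofReal (G T)
      ≤ ENNReal.ofReal β *
          (∫⁻ t in Ioc 0 T, ENNReal.ofReal (Real.exp (-(α * t) - ∫ s in (0:ℝ)..t, l s)))
        + ENNReal.ofReal (G 0) := by
  set W : ℝ → ℝ := fun t => Real.exp (-(α * t) - ∫ s in (0:ℝ)..t, l s) with hW
  set G2 : ℝ → ℝ := fun t => G 0 + ∫ s in (0:ℝ)..t, D s with hG2
  have h0 : (0:ℝ) ∈ uIcc 0 T := left_mem_uIcc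
  have acL := hl.absolutelyContinuousOnInterval_intervalIntegral h0
  have acD := hD.absolutelyContinuousOnInterval_intervalIntegral h0
  have acC : ∀ k : ℝ → ℝ, ContDiff ℝ 1 k → AbsolutelyContinuousOnInterval k 0 T :=
    fun k hk => hk.contDiffOn.absolutelyContinuousOnInterval
  have acP : AbsolutelyContinuousOnInterval (fun t => -(α * t) - ∫ s in (0:ℝ)..t, l s) 0 T :=
    (acC (fun t => -(α * t)) (by fun_prop)).fun_sub acL
  have hP0 : ∀ t ∈ Icc 0 T, -(α * t) - ∫ s in (0:ℝ)..t, l s ≤ 0 := by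
    intro t ht
    have : 0 ≤ ∫ s in (0:ℝ)..t, l s :=
      intervalIntegral.integral_nonneg ht.1 fun s hs => hl0 s ⟨hs.1, hs.2.trans ht.2⟩
    have := mul_nonneg hα ht.1
    linarith
  have acW : AbsolutelyContinuousOnInterval W 0 T := ac_exp hT acP hP0
  have acG : AbsolutelyContinuousOnInterval G2 0 T :=
    (acC (fun t => G 0) (by fun_prop)).fun_add acD
  have acWG := acW.fun_mul acG
  have hintegr := acWG.integral_deriv_eq_sub
  have hWpos : ∀ t, 0 < W t := fun t => Real.exp_pos _
  have hWint : IntervalIntegrable W volume 0 T := acW.continuousOn.intervalIntegrable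
  have hderiv : ∀ᵐ t, t ∈ Ioc 0 T → W t * V t ≤ β * W t - deriv (fun t => W t * G2 t) t := by
    filter_upwards [hl.ae_hasDerivAt_integral, hD.ae_hasDerivAt_integral] with t h1 h2 ht
    have htI : t ∈ Icc 0 T := ⟨ht.1.le, ht.2⟩
    have htu : t ∈ uIcc 0 T := by rwa [uIcc_of_le hT]
    have d1 := h1 htu 0 h0
    have d2 := h2 htu 0 h0
    have dW : HasDerivAt W (W t * (-(α * 1) - l t)) t :=
      ((((hasDerivAt_id t).const_mul α).neg).sub d1).exp
    have dG : HasDerivAt G2 (D t) t := d2.const_add _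
    rw [(dW.fun_mul dG).deriv]
    have := hV t ht
    have e : G2 t = G t := (hG t htI).symm
    rw [e]
    have := mul_le_mul_of_nonneg_left this (hWpos t).le
    nlinarith
  have hdi : IntervalIntegrable (fun t => β * W t - deriv (fun t => W t * G2 t) t) volume 0 T :=
    (hWint.const_mul β).sub acWG.intervalIntegrable_deriv
  have hI : IntegrableOn (fun t => β * W t - deriv (fun t => W t * G2 t) t) (Ioc 0 T) :=
    (intervalIntegrable_iff_integrableOn_Ioc_of_le hT).1 hdi
  have hderiv' := (ae_restrict_iff' (measurableSet_Ioc (a := (0:ℝ)) (b := T))).2 hderiv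
  have step1 : (∫⁻ t in Ioc 0 T, ENNReal.ofReal (W t) * ENNReal.ofReal (V t)) ≤
      ENNReal.ofReal (∫ t in (0:ℝ)..T, β * W t - deriv (fun t => W t * G2 t) t) := by
    rw [intervalIntegral.integral_of_le hT, ofReal_integral_eq_lintegral_ofReal hI]
    · apply lintegral_mono_ae
      filter_upwards [hderiv'] with t ht
      rw [← ENNReal.ofReal_mul (hWpos t).le]
      exact ENNReal.ofReal_le_ofReal ht
    · filter_upwards [hderiv', ae_restrict_mem (measurableSet_Ioc (a := (0:ℝ)) (b := T))] with t ht ht2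
      exact (mul_nonneg (hWpos t).le (hV0 t ht2)).trans ht
  have step2 : (∫ t in (0:ℝ)..T, β * W t - deriv (fun t => W t * G2 t) t)
      = β * (∫ t in (0:ℝ)..T, W t) - (W T * G T - G 0) := by
    rw [intervalIntegral.integral_sub (hWint.const_mul β) acWG.intervalIntegrable_deriv, hintegr,
      intervalIntegral.integral_const_mul]
    have e1 : G2 T = G T := (hG T ⟨hT, le_rfl⟩).symm
    have e2 : G2 0 = G 0 := by simp [hG2]
    have e3 : W 0 = 1 := by simp [hW]
    rw [e1, e2, e3, one_mul]
  have step3 : ENNReal.ofReal (∫ t in (0:ℝ)..T, W t) = ∫⁻ t in Ioc 0 T, ENNReal.ofReal (W t) := by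
    rw [intervalIntegral.integral_of_le hT, ofReal_integral_eq_lintegral_ofReal]
    · exact (intervalIntegrable_iff_integrableOn_Ioc_of_le hT).1 hWint
    · exact Eventually.of_forall fun t => (hWpos t).le
  have hIntW : 0 ≤ ∫ t in (0:ℝ)..T, W t :=
    intervalIntegral.integral_nonneg hT fun t _ => (hWpos t).le
  have hnn : 0 ≤ ∫ t in (0:ℝ)..T, β * W t - deriv (fun t => W t * G2 t) t := by
    rw [intervalIntegral.integral_of_le hT]
    apply setIntegral_nonneg_of_ae_restrict
    filter_upwards [hderiv', ae_restrict_mem (measurableSet_Ioc (a := (0:ℝ)) (b := T))] with t ht ht2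
    exact (mul_nonneg (hWpos t).le (hV0 t ht2)).trans ht
  have hWG : 0 ≤ W T * G T := mul_nonneg (hWpos T).le (hG0 T ⟨hT, le_rfl⟩)
  calc _ ≤ ENNReal.ofReal (∫ t in (0:ℝ)..T, β * W t - deriv (fun t => W t * G2 t) t)
        + ENNReal.ofReal (W T * G T) := by
        rw [ENNReal.ofReal_mul (hWpos T).le]
        gcongr
    _ = ENNReal.ofReal (β * (∫ t in (0:ℝ)..T, W t) + G 0) := by
        rw [← ENNReal.ofReal_add hnn hWG, step2]
        congr 1; ring
    _ = _ := by
        rw [ENNReal.ofReal_add (mul_nonneg hβ hIntW) (hG0 0 ⟨le_rfl, hT⟩), ENNReal.ofReal_mul hβ, step3]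

section flow
set_option linter.unusedSectionVars false
variable {n : ℕ} {U : Type*} [MeasurableSpace U] [MetricSpace U] [BorelSpace U]

theorem flow_cont {S : Setting n U} (hS : Basic S) (x : Fin n → ℝ) : Continuous (S.φ x) :=
  hS.contFlow.comp (Continuous.prodMk_right x)

theorem fs_mem_E {S : Setting n U} (hS : Basic S) {x : Fin n → ℝ} (hx : x ∈ S.E) {t : ℝ}
    (ht : t ∈ S.fs x) : S.φ x t ∈ S.E := by
  have hc := flow_cont hS x
  have hsub : Icc 0 t ⊆ S.φ x ⁻¹' S.E := by
    apply isPreconnected_Icc.subset_of_closure_inter_subset (hS.openE.preimage hc)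
    · exact ⟨0, ⟨le_rfl, ht.1⟩, by simpa [hS.flowZero] using hx⟩
    · rintro r ⟨hr, hr2⟩
      have h1 : S.φ x r ∈ closure S.E := hc.closure_preimage_subset _ hr
      by_contra h2
      have h3 : S.φ x r ∈ frontier S.E := by
        rw [hS.openE.frontier_eq]; exact ⟨h1, h2⟩
      have h0 : 0 < r := by
        rcases hr2.1.lt_or_eq with h | h
        · exact h
        · subst h
          exact absurd (by simpa [hS.flowZero] using hx) h2
      have h4 : S.ts x ≤ ENNReal.ofReal r := sInf_le ⟨r, h0, h3, rfl⟩
      exact absurd ht.2 (not_lt.2 (h4.trans (ENNReal.ofReal_le_ofReal hr2.2)))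
  exact hsub ⟨ht.1, le_rfl⟩

theorem ts_frontier {S : Setting n U} (hS : Basic S) {x : Fin n → ℝ} (hx : x ∈ S.E)
    (hts : S.ts x < ⊤) : 0 < S.tsR x ∧ S.φ x (S.tsR x) ∈ frontier S.E := by
  have hc := flow_cont hS x
  set A : Set ℝ := {t : ℝ | 0 ≤ t ∧ S.φ x t ∈ frontier S.E} with hA
  have hAc : IsClosed A := isClosed_Ici.inter (isClosed_frontier.preimage hc)
  have hpos : ∀ t ∈ A, 0 < t := by
    rintro t ⟨h0, h1⟩
    rcases h0.lt_or_eq with h | h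
    · exact h
    · subst h
      rw [hS.flowZero, hS.openE.frontier_eq] at h1
      exact absurd hx h1.2
  have hne : A.Nonempty := by
    by_contra hcon
    rw [Set.not_nonempty_iff_eq_empty] at hcon
    have : S.ts x = ⊤ := by
      unfold Setting.ts
      rw [sInf_eq_top]
      rintro T ⟨t, h0, h1, -⟩
      have : t ∈ A := ⟨h0.le, h1⟩
      simp [hcon] at this
    simp [this] at hts
  have hbdd : BddBelow A := ⟨0, fun t ht => ht.1⟩
  have hmem : sInf A ∈ A := hAc.csInf_mem hne hbdd
  have hts_eq : S.ts x = ENNReal.ofReal (sInf A) := by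
    apply le_antisymm
    · exact sInf_le ⟨_, hpos _ hmem, hmem.2, rfl⟩
    · apply le_sInf
      rintro T ⟨t, h0, h1, rfl⟩
      exact ENNReal.ofReal_le_ofReal (csInf_le hbdd ⟨h0.le, h1⟩)
  have : S.tsR x = sInf A := by
    unfold Setting.tsR; rw [hts_eq, ENNReal.toReal_ofReal hmem.1]
  rw [this]
  exact ⟨hpos _ hmem, hmem.2⟩

theorem zero_mem_fs {S : Setting n U} (hS : Basic S) {x : Fin n → ℝ} (hx : x ∈ S.E) :
    (0:ℝ) ∈ S.fs x := by
  refine ⟨le_rfl, ?_⟩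
  rw [ENNReal.ofReal_zero]
  by_cases hts : S.ts x < ⊤
  · have := (ts_frontier hS hx hts).1
    exact (ENNReal.toReal_pos_iff.1 this).1
  · rw [not_lt_top_iff.1 hts]; exact ENNReal.zero_lt_top

theorem fs_down {S : Setting n U} {x : Fin n → ℝ} {t r : ℝ} (ht : t ∈ S.fs x) (h0 : 0 ≤ r)
    (hr : r ≤ t) : r ∈ S.fs x :=
  ⟨h0, (ENNReal.ofReal_le_ofReal hr).trans_lt ht.2⟩

theorem fs_meas (S : Setting n U) (x : Fin n → ℝ) : MeasurableSet (S.fs x) :=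
  measurableSet_Ici.inter (measurableSet_lt ENNReal.measurable_ofReal measurable_const)

theorem fs_of_lt {S : Setting n U} {x : Fin n → ℝ} (hts : S.ts x < ⊤) {t : ℝ} :
    t ∈ S.fs x ↔ 0 ≤ t ∧ t < S.tsR x := by
  unfold Setting.fs Setting.tsR
  simp only [mem_ofPred_eq]
  constructor
  · rintro ⟨h0, h1⟩
    exact ⟨h0, (ENNReal.ofReal_lt_iff_lt_toReal h0 hts.ne).1 h1⟩
  · rintro ⟨h0, h1⟩
    exact ⟨h0, (ENNReal.ofReal_lt_iff_lt_toReal h0 hts.ne).2 h1⟩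

theorem exists_seq {S : Setting n U} (hS : Basic S) {x : Fin n → ℝ} (hx : x ∈ S.E) :
    ∃ T : ℕ → ℝ, Monotone T ∧ (∀ k, T k ∈ S.fs x) ∧ (⋃ k, Ioc 0 (T k)) = S.fs x \ {0} ∧
      (S.ts x < ⊤ → Tendsto T atTop (𝓝[<] (S.tsR x))) := by
  by_cases hts : S.ts x < ⊤
  · obtain ⟨h0, -⟩ := ts_frontier hS hx hts
    obtain ⟨T, h1, h2, h3⟩ := exists_seq_strictMono_tendsto' h0
    refine ⟨T, h1.monotone, fun k => (fs_of_lt hts).2 ⟨(h2 k).1.le, (h2 k).2⟩, ?_, fun _ => ?_⟩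
    · ext t
      simp only [mem_iUnion, mem_Ioc, Set.mem_sdiff, mem_singleton_iff, fs_of_lt hts]
      constructor
      · rintro ⟨k, h4, h5⟩
        exact ⟨⟨h4.le, h5.trans_lt (h2 k).2⟩, h4.ne'⟩
      · rintro ⟨⟨h4, h5⟩, h6⟩
        obtain ⟨k, hk⟩ := (h3.eventually (lt_mem_nhds h5)).exists
        exact ⟨k, lt_of_le_of_ne h4 (Ne.symm h6), hk.le⟩
    · exact tendsto_nhdsWithin_iff.2 ⟨h3, Eventually.of_forall fun k => (h2 k).2⟩
  · have htop := not_lt_top_iff.1 hts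
    have hfs : ∀ t, t ∈ S.fs x ↔ 0 ≤ t := fun t => by
      simp [Setting.fs, htop]
    refine ⟨fun k => k, Nat.mono_cast, fun k => (hfs _).2 (Nat.cast_nonneg k), ?_,
      fun h => absurd h hts⟩
    ext t
    simp only [mem_iUnion, mem_Ioc, Set.mem_sdiff, mem_singleton_iff, hfs]
    constructor
    · rintro ⟨k, h4, h5⟩
      exact ⟨h4.le, h4.ne'⟩
    · rintro ⟨h4, h6⟩
      obtain ⟨k, hk⟩ := exists_nat_ge t
      exact ⟨k, lt_of_le_of_ne h4 (Ne.symm h6), hk⟩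

theorem weight_meas (S : Setting n U) (α : ℝ) (x : Fin n → ℝ) (Θ : RControl U) :
    Measurable (S.weight α x Θ) := by
  have hm : Monotone (S.Lam x Θ) := fun a b hab =>
    lintegral_mono_set (Ioc_subset_Ioc_right hab)
  have hm' := hm.measurable
  unfold Setting.weight
  refine Measurable.ite (hm' (measurableSet_singleton ⊤)) measurable_const ?_
  fun_prop

/-- The jump rate along the flow under the feedback `u`. -/
def lrate (S : Setting n U) (u : (Fin n → ℝ) → U) (x : Fin n → ℝ) (t : ℝ) : ℝ :=
  S.lam (S.φ x t) (u (S.φ x t))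

theorem along_meas {S : Setting n U} (hS : Basic S) {u : (Fin n → ℝ) → U} (hu : S.IsSelector u)
    (x : Fin n → ℝ) {k : (Fin n → ℝ) → U → ℝ} (hk : Measurable (Function.uncurry k)) :
    Measurable fun t => k (S.φ x t) (u (S.φ x t)) := by
  have hc := (flow_cont hS x).measurable
  exact hk.comp (hc.prodMk (hu.1.comp hc))

theorem lrate_nonneg {S : Setting n U} (hS : Basic S) {u : (Fin n → ℝ) → U}
    {x : Fin n → ℝ} {t : ℝ} (ht : S.φ x t ∈ closure S.E) : 0 ≤ lrate S u x t :=
  hS.lamNonneg _ ht _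

/-- Admissible times: `[0,t*)`, together with `t*` when finite. -/
def Adm (S : Setting n U) (x : Fin n → ℝ) (t : ℝ) : Prop :=
  t ∈ S.fs x ∨ (S.ts x < ⊤ ∧ t = S.tsR x)

theorem adm_down {S : Setting n U} {x : Fin n → ℝ} {t r : ℝ} (ht : Adm S x t) (h0 : 0 ≤ r)
    (hr : r ≤ t) : Adm S x r := by
  rcases ht with ht | ⟨h1, rfl⟩
  · exact Or.inl (fs_down ht h0 hr)
  · rcases hr.lt_or_eq with h | h
    · exact Or.inl ((fs_of_lt h1).2 ⟨h0, h⟩)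
    · exact Or.inr ⟨h1, h⟩

theorem adm_closure {S : Setting n U} (hS : Basic S) {x : Fin n → ℝ} (hx : x ∈ S.E) {t : ℝ}
    (ht : Adm S x t) : 0 ≤ t ∧ S.φ x t ∈ closure S.E := by
  rcases ht with ht | ⟨h1, rfl⟩
  · exact ⟨ht.1, subset_closure (fs_mem_E hS hx ht)⟩
  · have := ts_frontier hS hx h1
    exact ⟨this.1.le, frontier_subset_closure this.2⟩

theorem lrate_lint {S : Setting n U} (hS : Basic S) {c Kl : ℝ} {lamL : (Fin n → ℝ) → ℝ}
    (hLR : LowerRate S c lamL Kl) {u : (Fin n → ℝ) → U} (hu : S.IsSelector u)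
    {x : Fin n → ℝ} (hx : x ∈ S.E) {t : ℝ} (ht : Adm S x t) :
    (∫⁻ s in Ioc 0 t, ENNReal.ofReal (lrate S u x s)) < ⊤ := by
  have h1 : (∫⁻ s in Ioc 0 t, ⨆ a ∈ S.feas (S.φ x s), ENNReal.ofReal (S.lam (S.φ x s) a)) < ⊤ := by
    rcases ht with ht | ⟨h1, rfl⟩
    · exact hLR.supInt x hx t ht
    · exact hLR.supIntTs x hx h1
  refine lt_of_le_of_lt (setLIntegral_mono' measurableSet_Ioc fun s hs => ?_) h1
  have h2 := (adm_closure hS hx (adm_down ht hs.1.le hs.2)).2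
  exact le_iSup₂_of_le (u (S.φ x s)) (hu.2 _ h2) le_rfl

theorem lrate_int {S : Setting n U} (hS : Basic S) {c Kl : ℝ} {lamL : (Fin n → ℝ) → ℝ}
    (hLR : LowerRate S c lamL Kl) {u : (Fin n → ℝ) → U} (hu : S.IsSelector u)
    {x : Fin n → ℝ} (hx : x ∈ S.E) {t : ℝ} (ht : Adm S x t) :
    IntervalIntegrable (lrate S u x) volume 0 t ∧
      ENNReal.ofReal (∫ s in (0:ℝ)..t, lrate S u x s) =
        ∫⁻ s in Ioc 0 t, ENNReal.ofReal (lrate S u x s) := by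
  have ht0 := (adm_closure hS hx ht).1
  have hnn : 0 ≤ᵐ[volume.restrict (Ioc 0 t)] lrate S u x := by
    filter_upwards [ae_restrict_mem measurableSet_Ioc] with s hs
    exact lrate_nonneg hS (adm_closure hS hx (adm_down ht hs.1.le hs.2)).2
  have hI : IntegrableOn (lrate S u x) (Ioc 0 t) :=
    ⟨(along_meas hS hu x hS.lamMeas).aestronglyMeasurable,
      (hasFiniteIntegral_iff_ofReal hnn).2 (lrate_lint hS hLR hu hx ht)⟩
  refine ⟨(intervalIntegrable_iff_integrableOn_Ioc_of_le ht0).2 hI, ?_⟩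
  rw [intervalIntegral.integral_of_le ht0, ofReal_integral_eq_lintegral_ofReal hI hnn]

theorem weight_eq {S : Setting n U} (hS : Basic S) {c Kl : ℝ} {lamL : (Fin n → ℝ) → ℝ}
    (hLR : LowerRate S c lamL Kl) {u : (Fin n → ℝ) → U} (hu : S.IsSelector u)
    {x : Fin n → ℝ} (hx : x ∈ S.E) {t : ℝ} (ht : Adm S x t) (α : ℝ) :
    S.weight α x (S.feedback u x) t =
      ENNReal.ofReal (Real.exp (-(α * t) - ∫ s in (0:ℝ)..t, lrate S u x s)) := by
  have e : S.Lam x (S.feedback u x) t = ∫⁻ s in Ioc 0 t, ENNReal.ofReal (lrate S u x s) := by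
    unfold Setting.Lam Setting.lamMix Setting.feedback lrate
    simp only [lintegral_dirac]
  have h1 := lrate_lint hS hLR hu hx ht
  have h2 := (lrate_int hS hLR hu hx ht).2
  have ht0 := (adm_closure hS hx ht).1
  have h3 : 0 ≤ ∫ s in (0:ℝ)..t, lrate S u x s :=
    intervalIntegral.integral_nonneg ht0 fun s hs =>
      lrate_nonneg hS (adm_closure hS hx (adm_down ht hs.1 hs.2)).2
  unfold Setting.weight
  rw [e, if_neg h1.ne, ← h2, ENNReal.toReal_ofReal h3]

theorem super {S : Setting n U} (hS : Basic S) {c Kl : ℝ} {lamL : (Fin n → ℝ) → ℝ}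
    (hLR : LowerRate S c lamL Kl) {u : (Fin n → ℝ) → U} (hu : S.IsSelector u)
    {α β : ℝ} (hα : 0 ≤ α) (hβ : 0 ≤ β) {h Xh V : (Fin n → ℝ) → ℝ} (hh : S.MemMac h Xh)
    (hh0 : ∀ y, 0 ≤ h y) (hV0 : ∀ y ∈ S.E, 0 ≤ V y)
    (hV : ∀ y ∈ S.E, Xh y + V y ≤ (S.lam y (u y) + α) * h y + β)
    {x : Fin n → ℝ} (hx : x ∈ S.E) :
    (∫⁻ t in S.fs x, S.weight α x (S.feedback u x) t * ENNReal.ofReal (V (S.φ x t)))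
      + (if S.ts x < ⊤ then S.weight α x (S.feedback u x) (S.tsR x)
          * ENNReal.ofReal (h (S.φ x (S.tsR x))) else 0)
      ≤ ENNReal.ofReal β * S.curlyL α x (S.feedback u x) + ENNReal.ofReal (h x) := by
  set w := S.weight α x (S.feedback u x) with hw
  have hfin : ∀ T ∈ S.fs x,
      (∫⁻ t in Ioc 0 T, w t * ENNReal.ofReal (V (S.φ x t))) + w T * ENNReal.ofReal (h (S.φ x T))
        ≤ ENNReal.ofReal β * S.curlyL α x (S.feedback u x) + ENNReal.ofReal (h x) := by
    intro T hT
    have hsub : ∀ t ∈ Icc 0 T, t ∈ S.fs x := fun t ht => fs_down hT ht.1 ht.2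
    have hsub' : ∀ t ∈ Ioc 0 T, t ∈ S.fs x := fun t ht => fs_down hT ht.1.le ht.2
    have hmac := hh.2.2.1 x hx
    have k := key_real (l := lrate S u x) (D := fun t => Xh (S.φ x t)) (G := fun t => h (S.φ x t))
      (V := fun t => V (S.φ x t)) hT.1 hα hβ (lrate_int hS hLR hu hx (Or.inl hT)).1
      (fun t ht => lrate_nonneg hS (subset_closure (fs_mem_E hS hx (hsub t ht))))
      (hmac T hT).1
      (fun t ht => by have := (hmac t (hsub t ht)).2; simp only [hS.flowZero]; linarith)
      (fun t ht => hh0 _) (fun t ht => hV0 _ (fs_mem_E hS hx (hsub' t ht)))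
      (fun t ht => hV _ (fs_mem_E hS hx (hsub' t ht)))
    have ew : ∀ t ∈ S.fs x, w t =
      ENNReal.ofReal (Real.exp (-(α * t) - ∫ s in (0:ℝ)..t, lrate S u x s)) :=
      fun t ht => weight_eq hS hLR hu hx (Or.inl ht) α
    rw [setLIntegral_congr_fun measurableSet_Ioc
      (g := fun t => ENNReal.ofReal (Real.exp (-(α * t) - ∫ s in (0:ℝ)..t, lrate S u x s))
        * ENNReal.ofReal (V (S.φ x t))) (fun t ht => by simp only [ew t (hsub' t ht)]), ew T hT]
    refine k.trans ?_
    simp only [hS.flowZero]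
    gcongr
    unfold Setting.curlyL
    rw [← hw, setLIntegral_congr_fun measurableSet_Ioc
      (g := w) (fun t ht => (ew t (hsub' t ht)).symm)]
    exact lintegral_mono_set hsub'
  obtain ⟨T, hTm, hTf, hTU, hTt⟩ := exists_seq hS hx
  have hIeq : (∫⁻ t in S.fs x, w t * ENNReal.ofReal (V (S.φ x t)))
      = ⨆ k, ∫⁻ t in Ioc 0 (T k), w t * ENNReal.ofReal (V (S.φ x t)) := by
    rw [← setLIntegral_iUnion_of_directed, hTU]
    · exact setLIntegral_congr (sdiff_null_ae_eq_self (by simp)).symm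
    · exact (monotone_nat_of_le_succ fun k =>
        Ioc_subset_Ioc_right (hTm (Nat.le_succ k))).directed_le
  have hmono : Monotone fun k => ∫⁻ t in Ioc 0 (T k), w t * ENNReal.ofReal (V (S.φ x t)) :=
    fun i j hij => lintegral_mono_set (Ioc_subset_Ioc_right (hTm hij))
  rw [hIeq]
  split_ifs with hts
  · have h1 := tendsto_atTop_iSup hmono
    have hR := ts_frontier hS hx hts
    have hadm : Adm S x (S.tsR x) := Or.inr ⟨hts, rfl⟩
    have hcont : ContinuousOn (fun t => ∫ s in (0:ℝ)..t, lrate S u x s) (uIcc 0 (S.tsR x)) :=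
      ((lrate_int hS hLR hu hx hadm).1.absolutelyContinuousOnInterval_intervalIntegral
        left_mem_uIcc).continuousOn
    have hTin : Tendsto T atTop (𝓝[uIcc 0 (S.tsR x)] (S.tsR x)) := by
      refine tendsto_nhdsWithin_iff.2 ⟨(hTt hts).mono_right nhdsWithin_le_nhds,
        Eventually.of_forall fun k => ?_⟩
      have := (fs_of_lt hts).1 (hTf k)
      rw [uIcc_of_le hR.1.le]
      exact ⟨this.1, this.2.le⟩
    have hL : Tendsto (fun k => ∫ s in (0:ℝ)..(T k), lrate S u x s) atTop
        (𝓝 (∫ s in (0:ℝ)..(S.tsR x), lrate S u x s)) :=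
      (hcont _ right_mem_uIcc).tendsto.comp hTin
    have hTR : Tendsto T atTop (𝓝 (S.tsR x)) := (hTt hts).mono_right nhdsWithin_le_nhds
    have hWt : Tendsto (fun k => w (T k)) atTop (𝓝 (w (S.tsR x))) := by
      simp only [hw, fun k => weight_eq hS hLR hu hx (Or.inl (hTf k)) α,
        weight_eq hS hLR hu hx hadm α]
      exact ENNReal.tendsto_ofReal
        ((Real.continuous_exp.tendsto _).comp ((hTR.const_mul α).neg.sub hL))
    have hht : Tendsto (fun k => ENNReal.ofReal (h (S.φ x (T k)))) atTop
        (𝓝 (ENNReal.ofReal (h (S.φ x (S.tsR x))))) :=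
      ENNReal.tendsto_ofReal ((hh.2.2.2 x hx hts).comp (hTt hts))
    have hwf : w (S.tsR x) ≠ ⊤ := by
      rw [hw, weight_eq hS hLR hu hx hadm α]; exact ENNReal.ofReal_ne_top
    have hprod := ENNReal.Tendsto.mul hWt (Or.inr ENNReal.ofReal_ne_top) hht (Or.inr hwf)
    exact le_of_tendsto' (h1.add hprod) fun k => hfin _ (hTf k)
  · rw [add_zero]
    exact iSup_le fun k => le_trans le_self_add (hfin _ (hTf k))


theorem drift_real {S : Setting n U} {b c : ℝ} {g Xg rbar : (Fin n → ℝ) → ℝ}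
    (hEG : ExpGrowth S b c g Xg rbar) {y : Fin n → ℝ} (hy : y ∈ S.E) {a : U} (ha : a ∈ S.feas y) :
    ENNReal.ofReal (S.lam y a) * S.Qpt (fun z => ENNReal.ofReal (g z)) y a ≠ ⊤ ∧
    Xg y + c * g y
      + (ENNReal.ofReal (S.lam y a) * S.Qpt (fun z => ENNReal.ofReal (g z)) y a).toReal
      ≤ b + S.lam y a * g y := by
  have h := hEG.drift y hy a ha
  set q := ENNReal.ofReal (S.lam y a) * S.Qpt (fun z => ENNReal.ofReal (g z)) y a with hq
  have hne : q ≠ ⊤ := by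
    intro hc
    rw [hc, EReal.coe_ennreal_top, EReal.coe_add_top, top_le_iff] at h
    exact EReal.coe_ne_top _ h
  refine ⟨hne, ?_⟩
  have e : ((q : ℝ≥0∞) : EReal) = ((q.toReal : ℝ) : EReal) :=
    (EReal.coe_ennreal_toReal hne).symm
  rw [e, ← EReal.coe_add, EReal.coe_le_coe_iff] at h
  exact h

theorem mac_affine {S : Setting n U} {g Xg : (Fin n → ℝ) → ℝ} (hg : S.MemMac g Xg) (K1 K2 : ℝ) :
    S.MemMac (fun y => K1 * g y + K2) (fun y => K1 * Xg y) := by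
  obtain ⟨h1, h2, h3, h4⟩ := hg
  refine ⟨(h1.const_mul K1).add_const K2, h2.const_mul K1, fun x hx t ht => ?_, fun x hx hts => ?_⟩
  · obtain ⟨h5, h6⟩ := h3 x hx t ht
    refine ⟨h5.const_mul K1, ?_⟩
    rw [intervalIntegral.integral_const_mul, ← h6]
    ring
  · exact ((h4 x hx hts).const_mul K1).add_const K2

theorem Qpt_le {S : Setting n U} (hS : Basic S) {g k : (Fin n → ℝ) → ℝ} (hg : Measurable g)
    (hg0 : ∀ y, 0 ≤ g y) {K1 K2 : ℝ} (hK1 : 0 ≤ K1) (hK2 : 0 ≤ K2)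
    (hk : ∀ y ∈ S.E, k y ≤ K1 * g y + K2) (y : Fin n → ℝ) (a : U) :
    S.Qpt (fun z => ENNReal.ofReal (k z)) y a ≤
      ENNReal.ofReal K1 * S.Qpt (fun z => ENNReal.ofReal (g z)) y a + ENNReal.ofReal K2 := by
  unfold Setting.Qpt
  have h1 : (∫⁻ z in S.E, ENNReal.ofReal (k z) ∂(S.Q y a)) ≤
      ∫⁻ z in S.E, (ENNReal.ofReal K1 * ENNReal.ofReal (g z) + ENNReal.ofReal K2) ∂(S.Q y a) := by
    apply setLIntegral_mono' hS.openE.measurableSet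
    intro z hz
    rw [← ENNReal.ofReal_mul hK1, ← ENNReal.ofReal_add (mul_nonneg hK1 (hg0 z)) hK2]
    exact ENNReal.ofReal_le_ofReal (hk z hz)
  refine h1.trans (le_of_eq ?_)
  rw [lintegral_add_right _ measurable_const, lintegral_const_mul _ hg.ennreal_ofReal,
    lintegral_const, Measure.restrict_apply_univ, hS.QsuppE, mul_one]

theorem iterate_step {S : Setting n U} (hS : Basic S)
    {b c δ M : ℝ} {g Xg rbar lamL : (Fin n → ℝ) → ℝ} {Kl : ℝ}
    {f r : (Fin n → ℝ) → U → ℝ}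
    (hEG : ExpGrowth S b c g Xg rbar) (hCB : CostBound S c δ M g rbar f r)
    (hLR : LowerRate S c lamL Kl)
    {α : ℝ} (hα0 : 0 < α) (hαδ : α < δ)
    {u : (Fin n → ℝ) → U} (hu : S.IsSelector u) {k : (Fin n → ℝ) → ℝ}
    (hk : ∀ y ∈ S.E, k y ≤ M / (c + α) * g y + M / (c + α) * b / α)
    {x : Fin n → ℝ} (hx : x ∈ S.E) :
    S.Lop α (S.mix f) x (S.feedback u x) + S.Hop α (S.mix r) x (S.feedback u x)
          + S.Gop α (fun z => ENNReal.ofReal (k z)) x (S.feedback u x)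
      ≤ ENNReal.ofReal (M / (c + α) * g x + M / (c + α) * b / α) := by
  have hc := hEG.c_pos
  have hb := hEG.b_nonneg
  have hM := hCB.M_nonneg
  set K1 := M / (c + α) with hK1d
  set K2 := K1 * b / α with hK2d
  have hK1 : 0 ≤ K1 := by positivity
  have hK2 : 0 ≤ K2 := by positivity
  have hK1e : K1 * (c + α) = M := by rw [hK1d]; field_simp
  have hK2e : K2 * α = K1 * b := by rw [hK2d]; field_simp
  have hg0 : ∀ y, 0 ≤ g y := fun y => zero_le_one.trans (hEG.g_ge_one y)
  set q : (Fin n → ℝ) → ℝ≥0∞ := fun y =>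
    ENNReal.ofReal (S.lam y (u y)) * S.Qpt (fun z => ENNReal.ofReal (g z)) y (u y) with hq
  set V : (Fin n → ℝ) → ℝ := fun y => f y (u y) + (K1 * (q y).toReal + S.lam y (u y) * K2) with hVd
  have huE : ∀ y ∈ S.E, u y ∈ S.feas y := fun y hy => hu.2 y (subset_closure hy)
  have hl0 : ∀ y ∈ S.E, 0 ≤ S.lam y (u y) := fun y hy => hS.lamNonneg y (subset_closure hy) _
  have hf0 : ∀ y ∈ S.E, 0 ≤ f y (u y) := fun y hy => hCB.f_nonneg y (subset_closure hy) _
  have hW0 : ∀ y ∈ S.E, 0 ≤ K1 * (q y).toReal + S.lam y (u y) * K2 := fun y hy =>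
    add_nonneg (mul_nonneg hK1 ENNReal.toReal_nonneg) (mul_nonneg (hl0 y hy) hK2)
  have hsup := super hS hLR hu hα0.le le_rfl (mac_affine hEG.g_mac K1 K2)
    (fun y => add_nonneg (mul_nonneg hK1 (hg0 y)) hK2) (V := V)
    (fun y hy => add_nonneg (hf0 y hy) (hW0 y hy))
    (fun y hy => by
      have h1 := (drift_real hEG hy (huE y hy)).2
      have h2 := hCB.f_bound y hy _ (huE y hy)
      have h3 := mul_le_mul_of_nonneg_left h1 hK1
      rw [← hK1e] at h2
      simp only [hVd]
      nlinarith) hx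
  rw [ENNReal.ofReal_zero, zero_mul, zero_add] at hsup
  refine le_trans ?_ hsup
  have hL : S.Lop α (S.mix f) x (S.feedback u x)
      + S.Lop α (fun y m => S.lamQMix (fun z => ENNReal.ofReal (k z)) y m) x (S.feedback u x)
      ≤ ∫⁻ t in S.fs x, S.weight α x (S.feedback u x) t * ENNReal.ofReal (V (S.φ x t)) := by
    unfold Setting.Lop
    rw [← lintegral_add_left]
    · apply setLIntegral_mono' (fs_meas S x)
      intro t ht
      have hy := fs_mem_E hS hx ht
      rw [← mul_add]
      gcongr
      simp only [Setting.mix, Setting.lamQMix, Setting.feedback, lintegral_dirac]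
      simp only [hVd]
      rw [ENNReal.ofReal_add (hf0 _ hy) (hW0 _ hy),
        ENNReal.ofReal_add (mul_nonneg hK1 ENNReal.toReal_nonneg) (mul_nonneg (hl0 _ hy) hK2),
        ENNReal.ofReal_mul hK1, ENNReal.ofReal_toReal (drift_real hEG hy (huE _ hy)).1,
        ENNReal.ofReal_mul (hl0 _ hy)]
      gcongr
      calc _ ≤ ENNReal.ofReal (S.lam (S.φ x t) (u (S.φ x t))) * _ :=
            mul_le_mul_right (Qpt_le hS hEG.g_mac.1 hg0 hK1 hK2 hk _ _) _
        _ = _ := by ring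
    · refine (weight_meas S α x _).mul ?_
      simp only [Setting.mix, Setting.feedback, lintegral_dirac]
      exact (along_meas hS hu x hCB.f_meas).ennreal_ofReal
  have hH : S.Hop α (S.mix r) x (S.feedback u x)
      + S.Hop α (fun y m => S.QMix (fun z => ENNReal.ofReal (k z)) y m) x (S.feedback u x)
      ≤ (if S.ts x < ⊤ then S.weight α x (S.feedback u x) (S.tsR x)
          * ENNReal.ofReal (K1 * g (S.φ x (S.tsR x)) + K2) else 0) := by
    unfold Setting.Hop
    split_ifs with hts
    · rw [← mul_add]
      gcongr
      simp only [Setting.mix, Setting.QMix, Setting.feedback, lintegral_dirac]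
      have hfr := (ts_frontier hS hx hts).2
      set z := S.φ x (S.tsR x) with hz
      have huz : u z ∈ S.feas z := hu.2 z (frontier_subset_closure hfr)
      have hr1 := hCB.r_bound x hx hts (u z) huz
      have hB := hEG.bdryGrowth x hx hts (u z) huz
      rw [← hz] at hr1 hB
      have hrb := hEG.rbar_nonneg z hfr
      have hr2 : r z (u z) ≤ K1 * rbar z := by
        refine hr1.trans (mul_le_mul_of_nonneg_right ?_ hrb)
        rw [hK1d]
        gcongr
      calc _ ≤ ENNReal.ofReal K1 * ENNReal.ofReal (rbar z) +
            (ENNReal.ofReal K1 * S.Qpt (fun z => ENNReal.ofReal (g z)) z (u z)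
              + ENNReal.ofReal K2) := by
            rw [← ENNReal.ofReal_mul hK1]
            exact add_le_add (ENNReal.ofReal_le_ofReal hr2)
              (Qpt_le hS hEG.g_mac.1 hg0 hK1 hK2 hk _ _)
        _ = ENNReal.ofReal K1 * (ENNReal.ofReal (rbar z) +
              S.Qpt (fun z => ENNReal.ofReal (g z)) z (u z)) + ENNReal.ofReal K2 := by ring
        _ ≤ ENNReal.ofReal K1 * ENNReal.ofReal (g z) + ENNReal.ofReal K2 := by gcongr
        _ = _ := by rw [← ENNReal.ofReal_mul hK1, ← ENNReal.ofReal_add (mul_nonneg hK1 (hg0 z)) hK2]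
    · simp
  calc _ = (S.Lop α (S.mix f) x (S.feedback u x)
      + S.Lop α (fun y m => S.lamQMix (fun z => ENNReal.ofReal (k z)) y m) x (S.feedback u x))
      + (S.Hop α (S.mix r) x (S.feedback u x)
      + S.Hop α (fun y m => S.QMix (fun z => ENNReal.ofReal (k z)) y m) x (S.feedback u x)) := by
        unfold Setting.Gop; ring
    _ ≤ _ := add_le_add hL hH

theorem curlyL_le {S : Setting n U} (hS : Basic S) {c Kl : ℝ} {lamL : (Fin n → ℝ) → ℝ}
    (hc : 0 ≤ c) (hLR : LowerRate S c lamL Kl) {u : (Fin n → ℝ) → U} (hu : S.IsSelector u)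
    {x : Fin n → ℝ} (hx : x ∈ S.E) :
    S.curlyL 0 x (S.feedback u x) ≤ ENNReal.ofReal Kl := by
  refine le_trans ?_ (hLR.intBound x hx)
  unfold Setting.curlyL
  apply setLIntegral_mono' (fs_meas S x)
  intro t ht
  rw [weight_eq hS hLR hu hx (Or.inl ht)]
  apply ENNReal.ofReal_le_ofReal
  rw [Real.exp_le_exp]
  have h1 : (∫ s in (0:ℝ)..t, lamL (S.φ x s)) ≤ ∫ s in (0:ℝ)..t, lrate S u x s := by
    apply intervalIntegral.integral_mono_on ht.1 (hLR.lamL_locInt x hx t ht)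
      (lrate_int hS hLR hu hx (Or.inl ht)).1
    intro s hs
    have := fs_mem_E hS hx (fs_down ht hs.1 hs.2)
    exact hLR.lam_ge _ this _ (hu.2 _ (subset_closure this))
  have := mul_nonneg hc ht.1
  linarith

theorem undisc {S : Setting n U} (hS : Basic S)
    {b c : ℝ} {g Xg rbar lamL : (Fin n → ℝ) → ℝ} {Kl : ℝ}
    (hEG : ExpGrowth S b c g Xg rbar)
    (hLR : LowerRate S c lamL Kl)
    {u : (Fin n → ℝ) → U} (hu : S.IsSelector u)
    {x : Fin n → ℝ} (hx : x ∈ S.E) :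
    (∫⁻ t in S.fs x, S.weight 0 x (S.feedback u x) t * ENNReal.ofReal (c * g (S.φ x t)))
      + (if S.ts x < ⊤ then S.weight 0 x (S.feedback u x) (S.tsR x)
          * ENNReal.ofReal (g (S.φ x (S.tsR x))) else 0)
      ≤ ENNReal.ofReal ((1 + b * Kl) * g x) := by
  have hc := hEG.c_pos
  have hb := hEG.b_nonneg
  have hKl := hLR.Kl_nonneg
  have hg0 : ∀ y, 0 ≤ g y := fun y => zero_le_one.trans (hEG.g_ge_one y)
  have hsup := super hS hLR hu le_rfl hb hEG.g_mac hg0 (V := fun y => c * g y)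
    (fun y _ => mul_nonneg hc.le (hg0 y))
    (fun y hy => by
      have h1 := (drift_real hEG hy (hu.2 y (subset_closure hy))).2
      have h2 : 0 ≤ (ENNReal.ofReal (S.lam y (u y))
        * S.Qpt (fun z => ENNReal.ofReal (g z)) y (u y)).toReal := ENNReal.toReal_nonneg
      rw [add_zero]
      linarith) hx
  refine hsup.trans ?_
  calc _ ≤ ENNReal.ofReal b * ENNReal.ofReal Kl + ENNReal.ofReal (g x) := by
        gcongr
        exact curlyL_le hS hc.le hLR hu hx
    _ = ENNReal.ofReal (b * Kl + g x) := by
        rw [← ENNReal.ofReal_mul hb, ← ENNReal.ofReal_add (mul_nonneg hb hKl) (hg0 x)]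
    _ ≤ _ := by
        apply ENNReal.ofReal_le_ofReal
        have := hEG.g_ge_one x
        nlinarith [mul_nonneg hb hKl]

end flow

open PDMP MeasureTheory ENNReal Set Filter Topology

/-- Lemma 3.8 of the paper: under the full expected growth and lower-rate conditions, for
`α ∈ (0,δ)` and the iterates `s_{m+1} = L_α f + H_α r + G_α s_m` along a feedback selector `u`,
one has `|L(f - α s_{m+1})(x,u_φ(x)) + H r(x,u_φ(x))| ≤ M' g(x)` with
`M' = M(1+b/c)(1+bK_λ)/c` (undiscounted operators `L = L_0`, `H = H_0`). -/
theorem lemma_3_8 {n : ℕ} {U : Type*} [MeasurableSpace U] [MetricSpace U]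
    [CompactSpace U] [BorelSpace U]
    (S : Setting n U) (hS : Basic S)
    (b c δ M : ℝ) (g Xg rbar lamL : (Fin n → ℝ) → ℝ) (Kl : ℝ)
    (f r : (Fin n → ℝ) → U → ℝ)
    (hEG : ExpGrowth S b c g Xg rbar) (hCB : CostBound S c δ M g rbar f r)
    (hLR : LowerRate S c lamL Kl)
    (α : ℝ) (hα0 : 0 < α) (hαδ : α < δ)
    (u : (Fin n → ℝ) → U) (hu : S.IsSelector u)
    (s : ℕ → (Fin n → ℝ) → ℝ)
    (hs_meas : ∀ m, Measurable (s m))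
    (hs_nonneg : ∀ m x, 0 ≤ s m x)
    (hs0 : ∀ x, s 0 x = 0)
    (hs_rec : ∀ m : ℕ, ∀ x ∈ S.E,
      ENNReal.ofReal (s (m + 1) x) =
        S.Lop α (S.mix f) x (S.feedback u x) + S.Hop α (S.mix r) x (S.feedback u x)
          + S.Gop α (fun z => ENNReal.ofReal (s m z)) x (S.feedback u x))
    (m : ℕ) (x : Fin n → ℝ) (hx : x ∈ S.E) :
    |(∫ t in S.fs x, (S.weight 0 x (S.feedback u x) t).toReal *
          (f (S.φ x t) (u (S.φ x t)) - α * s (m + 1) (S.φ x t)))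
        + (S.Hop 0 (S.mix r) x (S.feedback u x)).toReal|
      ≤ M * (1 + b / c) * (1 + b * Kl) / c * g x := by
  have hc := hEG.c_pos
  have hb := hEG.b_nonneg
  have hM := hCB.M_nonneg
  have hKl := hLR.Kl_nonneg
  have hg1 := hEG.g_ge_one
  have hg0 : ∀ y, 0 ≤ g y := fun y => zero_le_one.trans (hg1 y)
  -- bound on the iterates
  have hs_bd : ∀ m, ∀ y ∈ S.E, s m y ≤ M / (c + α) * g y + M / (c + α) * b / α := by
    intro m
    induction m with
    | zero =>
      intro y _
      rw [hs0]
      have := hg0 y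
      positivity
    | succ k ih =>
      intro y hy
      have h1 := iterate_step hS hEG hCB hLR hα0 hαδ hu ih hy
      rw [← hs_rec k y hy] at h1
      have := hg0 y
      exact (ENNReal.ofReal_le_ofReal_iff (by positivity)).1 h1
  have hs_bd2 : ∀ y ∈ S.E, α * s (m + 1) y ≤ M * (1 + b / c) * g y := by
    intro y hy
    have h1 := mul_le_mul_of_nonneg_left (hs_bd (m + 1) y hy) hα0.le
    have h2 : α * (M / (c + α) * g y + M / (c + α) * b / α)
        = M * (α / (c + α) * g y + b / (c + α) * 1) := by field_simp
    have h3 : α / (c + α) ≤ 1 := by rw [div_le_one (by linarith)]; linarith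
    have h4 : b / (c + α) ≤ b / c := by gcongr; linarith
    have h5 : b / (c + α) * 1 ≤ b / c * g y :=
      mul_le_mul h4 (hg1 y) zero_le_one (by positivity)
    have h6 : α / (c + α) * g y ≤ 1 * g y := mul_le_mul_of_nonneg_right h3 (hg0 y)
    rw [h2] at h1
    refine h1.trans ?_
    rw [mul_assoc]
    apply mul_le_mul_of_nonneg_left _ hM
    linarith
  have hund := undisc hS hEG hLR hu hx
  set B := (1 + b * Kl) * g x with hB
  have hB0 : 0 ≤ B := mul_nonneg (by positivity) (hg0 x)
  set w := S.weight 0 x (S.feedback u x) with hw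
  set J : ℝ≥0∞ := if S.ts x < ⊤ then w (S.tsR x)
          * ENNReal.ofReal (g (S.φ x (S.tsR x))) else 0 with hJ
  have hwm : Measurable w := weight_meas S 0 x _
  have hwtop : ∀ t ∈ S.fs x, w t ≠ ⊤ := fun t ht => by
    rw [hw, weight_eq hS hLR hu hx (Or.inl ht)]; exact ENNReal.ofReal_ne_top
  have hφm := (flow_cont hS x).measurable
  have hgm : Measurable fun t => g (S.φ x t) := hEG.g_mac.1.comp hφm
  have hfsm := fs_meas S x
  set p : ℝ → ℝ := fun t => (w t).toReal * (c * g (S.φ x t)) with hp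
  have hp0 : ∀ t, 0 ≤ p t := fun t =>
    mul_nonneg ENNReal.toReal_nonneg (mul_nonneg hc.le (hg0 _))
  have hpm : Measurable p := hwm.ennreal_toReal.mul (hgm.const_mul c)
  have hpl : (∫⁻ t in S.fs x, ENNReal.ofReal (p t))
      = ∫⁻ t in S.fs x, w t * ENNReal.ofReal (c * g (S.φ x t)) := by
    apply setLIntegral_congr_fun hfsm
    intro t ht
    simp only [hp]
    rw [ENNReal.ofReal_mul ENNReal.toReal_nonneg, ENNReal.ofReal_toReal (hwtop t ht)]
  have hIp : IntegrableOn p (S.fs x) := by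
    refine ⟨hpm.aestronglyMeasurable, ?_⟩
    rw [hasFiniteIntegral_iff_ofReal (Eventually.of_forall hp0), hpl]
    exact lt_of_le_of_lt (le_self_add.trans hund) ENNReal.ofReal_lt_top
  have hJtop : J ≠ ⊤ := ((le_add_self.trans hund).trans_lt ENNReal.ofReal_lt_top).ne
  set P := ∫ t in S.fs x, p t with hP
  have hP0 : 0 ≤ P := integral_nonneg hp0
  have hPJ : P + J.toReal ≤ B := by
    have h1 : ENNReal.ofReal P + J ≤ ENNReal.ofReal B := by
      rw [hP, ofReal_integral_eq_lintegral_ofReal hIp (Eventually.of_forall hp0), hpl]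
      exact hund
    rw [← ENNReal.ofReal_toReal hJtop, ← ENNReal.ofReal_add hP0 ENNReal.toReal_nonneg] at h1
    exact (ENNReal.ofReal_le_ofReal_iff hB0).1 h1
  have hmc : 0 ≤ M / c := by positivity
  -- boundary term
  have hHr : (S.Hop 0 (S.mix r) x (S.feedback u x)).toReal ≤ M / c * J.toReal := by
    have h1 : S.Hop 0 (S.mix r) x (S.feedback u x) ≤ ENNReal.ofReal (M / c) * J := by
      unfold Setting.Hop
      rw [hJ]
      split_ifs with hts
      · rw [mul_left_comm]
        gcongr
        simp only [Setting.mix, Setting.feedback, lintegral_dirac]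
        rw [← ENNReal.ofReal_mul hmc]
        apply ENNReal.ofReal_le_ofReal
        have hfr := (ts_frontier hS hx hts).2
        have huz := hu.2 _ (frontier_subset_closure hfr)
        have h2 := hCB.r_bound x hx hts _ huz
        have h3 := (ENNReal.ofReal_le_ofReal_iff (hg0 _)).1
          (le_self_add.trans (hEG.bdryGrowth x hx hts _ huz))
        have h4 := hEG.rbar_nonneg _ hfr
        have hδ := hCB.δ_pos
        have h5 : M / (c + δ) ≤ M / c := by gcongr; linarith
        exact h2.trans (mul_le_mul h5 h3 h4 hmc)
      · simp
    have h2 := ENNReal.toReal_mono (ENNReal.mul_ne_top ENNReal.ofReal_ne_top hJtop) h1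
    rwa [ENNReal.toReal_mul, ENNReal.toReal_ofReal hmc] at h2
  -- generic estimate
  have hgen : ∀ (v : ℝ → ℝ) (K : ℝ), Measurable v → (∀ t ∈ S.fs x, 0 ≤ v t) →
      (∀ t ∈ S.fs x, v t ≤ K * g (S.φ x t)) →
      IntegrableOn (fun t => (w t).toReal * v t) (S.fs x) ∧
      0 ≤ (∫ t in S.fs x, (w t).toReal * v t) ∧
      (∫ t in S.fs x, (w t).toReal * v t) ≤ K / c * P := by
    intro v K hv hv0 hvK
    have hle : ∀ t ∈ S.fs x, (w t).toReal * v t ≤ K / c * p t := by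
      intro t ht
      have e : K / c * p t = (w t).toReal * (K * g (S.φ x t)) := by
        simp only [hp]; field_simp
      rw [e]
      exact mul_le_mul_of_nonneg_left (hvK t ht) ENNReal.toReal_nonneg
    have hI : IntegrableOn (fun t => (w t).toReal * v t) (S.fs x) := by
      refine Integrable.mono' (hIp.const_mul (K / c))
        (hwm.ennreal_toReal.mul hv).aestronglyMeasurable ?_
      filter_upwards [ae_restrict_mem hfsm] with t ht
      rw [Real.norm_of_nonneg (mul_nonneg ENNReal.toReal_nonneg (hv0 t ht))]
      exact hle t ht
    refine ⟨hI, setIntegral_nonneg hfsm fun t ht =>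
      mul_nonneg ENNReal.toReal_nonneg (hv0 t ht), ?_⟩
    rw [hP, ← integral_const_mul]
    exact setIntegral_mono_on hI (hIp.const_mul (K / c)) hfsm hle
  obtain ⟨f1, f2, f3⟩ := hgen (fun t => f (S.φ x t) (u (S.φ x t))) M
    (along_meas hS hu x hCB.f_meas)
    (fun t ht => hCB.f_nonneg _ (subset_closure (fs_mem_E hS hx ht)) _)
    (fun t ht => hCB.f_bound _ (fs_mem_E hS hx ht) _
      (hu.2 _ (subset_closure (fs_mem_E hS hx ht))))
  obtain ⟨s1, s2, s3⟩ := hgen (fun t => α * s (m + 1) (S.φ x t)) (M * (1 + b / c))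
    (((hs_meas (m + 1)).comp hφm).const_mul α)
    (fun t ht => mul_nonneg hα0.le (hs_nonneg _ _))
    (fun t ht => hs_bd2 _ (fs_mem_E hS hx ht))
  have hsplit : (∫ t in S.fs x, (w t).toReal *
          (f (S.φ x t) (u (S.φ x t)) - α * s (m + 1) (S.φ x t)))
      = (∫ t in S.fs x, (w t).toReal * f (S.φ x t) (u (S.φ x t)))
        - ∫ t in S.fs x, (w t).toReal * (α * s (m + 1) (S.φ x t)) := by
    rw [← integral_sub f1 s1]
    simp only [mul_sub]
  rw [hsplit]
  have hH0 : 0 ≤ (S.Hop 0 (S.mix r) x (S.feedback u x)).toReal := ENNReal.toReal_nonneg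
  have hJ0 : 0 ≤ J.toReal := ENNReal.toReal_nonneg
  have hbc : 0 ≤ b / c := by positivity
  have e1 : M * (1 + b / c) * (1 + b * Kl) / c * g x = M / c * B + b / c * (M / c * B) := by
    rw [hB]; field_simp
  have e2 : M * (1 + b / c) / c * P = M / c * P + b / c * (M / c * P) := by field_simp
  have hmPJ := mul_le_mul_of_nonneg_left hPJ hmc
  have hmB : 0 ≤ M / c * B := mul_nonneg hmc hB0
  have hmJ : 0 ≤ M / c * J.toReal := mul_nonneg hmc hJ0
  rw [mul_add] at hmPJ
  have hbm : b / c * (M / c * P) ≤ b / c * (M / c * B) :=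
    mul_le_mul_of_nonneg_left (by linarith) hbc
  have hbB : 0 ≤ b / c * (M / c * B) := mul_nonneg hbc hmB
  rw [e1, abs_le]
  rw [e2] at s3
  constructor <;> linarith
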